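/- arXiv:2502.14790 — 8 statements merged into one kernel-verified Lean document; each statement's English description precedes it below -/
import Mathlib

section
/- Let X be a compact metrizable topological space, T ∈ ℕ a horizon, and μ a Borel probability measure on the product C(X,ℝ)^T with ∫ Σ_{t=1}^T ‖γ_t‖∞ dμ(γ) < ∞. For 1 ≤ t ≤ T+1 define Γ*_t(f) = ∫ max_{x∈X} ( f(x) + Σ_{τ=t}^T γ_τ(x) ) dμ(γ) (empty sum equal to 0). Let P = (P_t)_{t=1}^T be a learner strategy, let y_1,…,y_T ∈ C(X,ℝ), set p_t = P_t(y_1,…,y_{t−1}) and y_{1:t} = Σ_{τ=1}^t y_τ, and assume each map γ ↦ ⟨γ_t, P_t(γ_1,…,γ_{t−1})⟩ is Borel measurable. Define the realized regret R(P,y) = max_{x∈X} Σ_{t=1}^T y_t(x) − Σ_{t=1}^T ⟨y_t, p_t⟩, the prior regret R(P,μ) = ∫ [ max_{x∈X} Σ_{t=1}^T γ_t(x) − Σ_{t=1}^T ⟨γ_t, P_t(γ_1,…,γ_{t−1})⟩ ] dμ(γ), and the excess regret E_μ(P,y) = Σ_{t=1}^T [ Γ*_{t+1}(y_{1:t}) −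 Γ*_t(y_{1:t−1}) − ⟨y_t, p_t⟩ + ∫ ⟨γ_t, P_t(γ_1,…,γ_{t−1})⟩ dμ(γ) ]. Then R(P,y) = R(P,μ) + E_μ(P,y). -/
open MeasureTheory Finset

/-- The maximum over a compact space `X` of a continuous function, written as a supremum
(which is attained by compactness). -/
noncomputable def supVal {X : Type*} [TopologicalSpace X] (f : C(X, ℝ)) : ℝ := ⨆ x, f x

/-- `headSum y t = Σ_{τ < t} y τ` (0-based), i.e. the sum of the first `t` reward
functions. -/
noncomputable def headSum {X : Type*} [TopologicalSpace X] {T : ℕ}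
    (y : Fin T → C(X, ℝ)) (t : ℕ) : C(X, ℝ) :=
  ∑ τ ∈ Finset.univ.filter (fun τ : Fin T => (τ : ℕ) < t), y τ

/-- `tailSum γ t = Σ_{τ ≥ t} γ τ` (0-based), i.e. the sum of the reward functions from
round `t` onwards (the empty sum being `0`). -/
noncomputable def tailSum {X : Type*} [TopologicalSpace X] {T : ℕ}
    (γ : Fin T → C(X, ℝ)) (t : ℕ) : C(X, ℝ) :=
  ∑ τ ∈ Finset.univ.filter (fun τ : Fin T => t ≤ (τ : ℕ)), γ τ

section

variable {X : Type*} [TopologicalSpace X]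

lemma supVal_le_of_norm_sub_le [CompactSpace X] [Nonempty X] (f g : C(X, ℝ)) :
    supVal f ≤ supVal g + ‖f - g‖ := by
  refine ciSup_le fun x => ?_
  have hg : g x ≤ supVal g := le_ciSup (isCompact_range g.continuous).bddAbove x
  have hfg : f x - g x ≤ ‖f - g‖ := (le_abs_self _).trans ((f - g).norm_coe_le_norm x)
  linarith

lemma lipschitzWith_supVal [CompactSpace X] [Nonempty X] :
    LipschitzWith 1 (supVal : C(X, ℝ) → ℝ) :=
  LipschitzWith.of_le_add fun f g => by
    rw [dist_eq_norm]
    exact supVal_le_of_norm_sub_le f g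

lemma abs_supVal_le_norm [CompactSpace X] [Nonempty X] (f : C(X, ℝ)) : |supVal f| ≤ ‖f‖ := by
  have h := lipschitzWith_supVal.dist_le_mul f 0
  have h0 : supVal (0 : C(X, ℝ)) = 0 := by simp [supVal]
  simpa [h0, Real.dist_eq] using h

lemma headSum_zero {T : ℕ} (y : Fin T → C(X, ℝ)) : headSum y 0 = 0 := by
  simp [headSum]

lemma headSum_horizon {T : ℕ} (y : Fin T → C(X, ℝ)) : headSum y T = ∑ t, y t := by
  simp [headSum]

lemma tailSum_zero {T : ℕ} (γ : Fin T → C(X, ℝ)) : tailSum γ 0 = ∑ t, γ t := by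
  simp [tailSum]

lemma tailSum_horizon {T : ℕ} (γ : Fin T → C(X, ℝ)) : tailSum γ T = 0 := by
  simp [tailSum, Finset.filter_false_of_mem, Fin.is_lt]

lemma abs_integral_le_norm [CompactSpace X] [MeasurableSpace X] (ν : Measure X)
    [IsProbabilityMeasure ν] (f : C(X, ℝ)) : |∫ x, f x ∂ν| ≤ ‖f‖ := by
  simpa using norm_integral_le_of_norm_le_const (μ := ν) (.of_forall f.norm_coe_le_norm)

lemma measurable_supVal_sum [CompactSpace X] [TopologicalSpace.MetrizableSpace X] [Nonempty X]
    [MeasurableSpace C(X, ℝ)] [BorelSpace C(X, ℝ)] {ι : Type*} [Fintype ι] :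
    Measurable fun γ : ι → C(X, ℝ) => supVal (∑ t, γ t) := by
  let := TopologicalSpace.metrizableSpaceMetric X
  exact lipschitzWith_supVal.continuous.measurable.comp
    (Finset.measurable_fun_sum _ fun t _ => measurable_pi_apply t)

lemma integrable_supVal_sum [CompactSpace X] [TopologicalSpace.MetrizableSpace X] [Nonempty X]
    [MeasurableSpace C(X, ℝ)] [BorelSpace C(X, ℝ)] {ι : Type*} [Fintype ι]
    {μ : Measure (ι → C(X, ℝ))} (hμ : Integrable (fun γ => ∑ t, ‖γ t‖) μ) :
    Integrable (fun γ : ι → C(X, ℝ) => supVal (∑ t, γ t)) μ :=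
  hμ.mono' measurable_supVal_sum.aestronglyMeasurable
    (.of_forall fun _ => (abs_supVal_le_norm _).trans (norm_sum_le _ _))

end

/-- regret decomposition: for a prior `μ` over the adversary's reward
sequences with `∫ Σ_t ‖γ_t‖∞ dμ < ∞` and a learner strategy `P`, with
`Γ*_t(f) = ∫ max_x (f(x) + Σ_{τ ≥ t} γ_τ(x)) dμ(γ)`, the realized regret against
`y` decomposes as prior regret plus excess regret.
Rounds are indexed `0, …, T−1`; the history at round `t` is `(y_0, …, y_{t−1})`. -/
theorem regret_decomposition {X : Type*} [TopologicalSpace X] [CompactSpace X]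
    [TopologicalSpace.MetrizableSpace X] [Nonempty X]
    [MeasurableSpace X] [BorelSpace X]
    [MeasurableSpace C(X, ℝ)] [BorelSpace C(X, ℝ)]
    (T : ℕ) (μ : Measure (Fin T → C(X, ℝ))) [IsProbabilityMeasure μ]
    (hμint : Integrable (fun γ : Fin T → C(X, ℝ) => ∑ t, ‖γ t‖) μ)
    (P : (t : Fin T) → (Fin (t : ℕ) → C(X, ℝ)) → ProbabilityMeasure X)
    (hP : ∀ t : Fin T, Measurable fun h : Fin (t : ℕ) → C(X, ℝ) => (P t h : Measure X))
    (y : Fin T → C(X, ℝ))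
    (hmeas : ∀ t : Fin T,
      Measurable fun γ : Fin T → C(X, ℝ) =>
        ∫ x, γ t x ∂(P t (fun τ => γ (Fin.castLE t.isLt.le τ)) : Measure X)) :
    -- realized regret R(P, y)
    (supVal (headSum y T) -
        ∑ t : Fin T, ∫ x, y t x ∂(P t (fun τ => y (Fin.castLE t.isLt.le τ)) : Measure X))
      =
    -- prior regret R(P, μ)
    (∫ γ : Fin T → C(X, ℝ),
        (supVal (headSum γ T) -
          ∑ t : Fin T,
            ∫ x, γ t x ∂(P t (fun τ => γ (Fin.castLE t.isLt.le τ)) : Measure X)) ∂μ)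
    +
    -- excess regret E_μ(P, y)
    (∑ t : Fin T,
      ((∫ γ, supVal (headSum y ((t : ℕ) + 1) + tailSum γ ((t : ℕ) + 1)) ∂μ)
        - (∫ γ, supVal (headSum y (t : ℕ) + tailSum γ (t : ℕ)) ∂μ)
        - (∫ x, y t x ∂(P t (fun τ => y (Fin.castLE t.isLt.le τ)) : Measure X))
        + (∫ γ : Fin T → C(X, ℝ),
            (∫ x, γ t x ∂(P t (fun τ => γ (Fin.castLE t.isLt.le τ)) : Measure X)) ∂μ))) := by
  have hpair (t : Fin T) : Integrable (fun γ : Fin T → C(X, ℝ) =>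
      ∫ x, γ t x ∂(P t (fun τ => γ (Fin.castLE t.isLt.le τ)) : Measure X)) μ :=
    hμint.mono' (hmeas t).aestronglyMeasurable (.of_forall fun γ =>
      (abs_integral_le_norm _ _).trans
        (Finset.single_le_sum (f := fun t => ‖γ t‖) (fun _ _ => norm_nonneg _)
          (Finset.mem_univ t)))
  have htel := Finset.sum_range_sub
    (fun t : ℕ => ∫ γ : Fin T → C(X, ℝ), supVal (headSum y t + tailSum γ t) ∂μ) T
  rw [Finset.sum_range] at htel
  simp only [headSum_zero, tailSum_zero, tailSum_horizon, zero_add, add_zero, integral_const,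
    probReal_univ, one_smul] at htel
  simp only [headSum_horizon y, headSum_horizon] at htel ⊢
  rw [integral_sub (integrable_supVal_sum hμint) (integrable_finsetSum _ fun t _ => hpair t),
    integral_finsetSum _ fun t _ => hpair t, Finset.sum_add_distrib, Finset.sum_sub_distrib,
    htel]
  ring
end

section
/- Let X be a compact metrizable topological space and μ a Borel probability measure on C(X,ℝ) with ∫ ‖γ‖∞ dμ(γ) < ∞, and define Γ*_μ(f) = ∫ max_{x∈X} ( f(x) + γ(x) ) dμ(γ). Assume that for every f ∈ C(X,ℝ), the set { γ ∈ C(X,ℝ) : f + γ has more than one maximum point on X } has μ-measure zero, and let A : C(X,ℝ) → X be a Borel-measurable maximizer selection. Then for all f, v ∈ C(X,ℝ), the one-sided Gâteaux derivative of Γ*_μ at f in direction v exists and satisfies lim_{ε→0⁺} ( Γ*_μ(f + εv) − Γ*_μ(f) ) / ε = ∫ v( A(f + γ) ) dμ(γ). -/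
open MeasureTheory Filter

/-- A maximizer selection is continuous at every function with a unique maximum point. -/
theorem continuousAt_maximizer_of_unique {X : Type*} [TopologicalSpace X] [CompactSpace X]
    {A : C(X, ℝ) → X} (hAmax : ∀ g : C(X, ℝ), ∀ x : X, g x ≤ g (A g)) {g : C(X, ℝ)}
    (huniq : ∀ y, (∀ z, g z ≤ g y) → y = A g) : ContinuousAt A g := by
  refine isCompact_univ.tendsto_nhds_of_unique_mapClusterPt (by simp) fun y _ hy => ?_
  refine huniq y fun z => not_lt.1 fun hlt => ?_
  have hopen : IsOpen {p : C(X, ℝ) × X | p.1 p.2 < p.1 z} :=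
    isOpen_lt (by fun_prop) (by fun_prop)
  obtain ⟨U, hU, V, hV, hUV⟩ := mem_nhds_prod_iff.1 (hopen.mem_nhds (x := (g, y)) hlt)
  obtain ⟨h, hhV, hhU⟩ := ((mapClusterPt_iff_frequently.1 hy V hV).and_eventually hU).exists
  exact (hUV (Set.mk_mem_prod hhU hhV)).not_ge (hAmax h z)

theorem supVal_eq_of_isMax {X : Type*} [TopologicalSpace X] {g : C(X, ℝ)} {x : X}
    (hx : ∀ z, g z ≤ g x) : supVal g = g x :=
  IsGreatest.csSup_eq ⟨Set.mem_range_self x, Set.forall_mem_range.2 hx⟩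

theorem abs_sub_supVal_le {X : Type*} [TopologicalSpace X] [CompactSpace X] [Nonempty X]
    (g h : C(X, ℝ)) : |supVal g - supVal h| ≤ ‖g - h‖ := by
  have key (g h : C(X, ℝ)) : supVal g ≤ supVal h + ‖g - h‖ := by
    refine ciSup_le fun x => ?_
    have h1 : h x ≤ supVal h := le_ciSup (isCompact_range h.continuous).bddAbove x
    have h2 := (le_abs_self _).trans ((g - h).norm_coe_le_norm x)
    rw [ContinuousMap.sub_apply] at h2
    linarith
  have h1 := key g h
  have h2 := key h g
  rw [norm_sub_rev] at h2
  exact abs_sub_le_iff.2 ⟨by linarith, by linarith⟩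

theorem continuous_supVal {X : Type*} [TopologicalSpace X] [CompactSpace X] [Nonempty X] :
    Continuous (supVal : C(X, ℝ) → ℝ) :=
  (LipschitzWith.of_dist_le_mul (K := 1) fun g h => by
    simpa [Real.dist_eq, dist_eq_norm] using abs_sub_supVal_le g h).continuous

theorem integrable_supVal_add {X : Type*} [TopologicalSpace X] [CompactSpace X] [Nonempty X]
    [MeasurableSpace C(X, ℝ)] [BorelSpace C(X, ℝ)] {μ : Measure C(X, ℝ)} [IsFiniteMeasure μ]
    (hμ : Integrable (fun γ : C(X, ℝ) => ‖γ‖) μ) (f : C(X, ℝ)) :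
    Integrable (fun γ => supVal (f + γ)) μ := by
  have hmeas : Measurable fun γ : C(X, ℝ) => supVal (f + γ) :=
    (continuous_supVal.comp (continuous_const.add continuous_id)).measurable
  refine (hμ.add (integrable_const |supVal f|)).mono' hmeas.aestronglyMeasurable
    (.of_forall fun γ => ?_)
  have h1 := abs_sub_supVal_le (f + γ) f
  rw [add_sub_cancel_left] at h1
  have h2 := abs_sub_abs_le_abs_sub (supVal (f + γ)) (supVal f)
  rw [Real.norm_eq_abs, Pi.add_apply]
  linarith

/-- The difference quotient of the maximum lies between the values of the direction at the
maximizers of the unperturbed and of the perturbed function. -/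
theorem supVal_quotient_mem_Icc {X : Type*} [TopologicalSpace X]
    {A : C(X, ℝ) → X} (hAmax : ∀ g : C(X, ℝ), ∀ x : X, g x ≤ g (A g)) (g v : C(X, ℝ))
    {ε : ℝ} (hε : 0 < ε) :
    (supVal (g + ε • v) - supVal g) / ε ∈ Set.Icc (v (A g)) (v (A (g + ε • v))) := by
  rw [supVal_eq_of_isMax (hAmax g), supVal_eq_of_isMax (hAmax (g + ε • v)), Set.mem_Icc,
    le_div_iff₀ hε, div_le_iff₀ hε]
  have h1 := hAmax g (A (g + ε • v))
  have h2 := hAmax (g + ε • v) (A g)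
  simp only [ContinuousMap.add_apply, ContinuousMap.smul_apply, smul_eq_mul] at h1 h2 ⊢
  constructor <;> linarith

/-- if ties almost never occur under `μ`, then the one-sided Gâteaux
derivative of `Γ*_μ(f) = ∫ max_x (f + γ)(x) dμ(γ)` at `f` in direction `v` exists and
equals `∫ v(A(f + γ)) dμ(γ)` for any Borel-measurable maximizer selection `A`. -/
theorem gammaStar_gateaux_derivative {X : Type*} [TopologicalSpace X] [CompactSpace X]
    [TopologicalSpace.MetrizableSpace X] [Nonempty X]
    [MeasurableSpace X] [BorelSpace X]
    [MeasurableSpace C(X, ℝ)] [BorelSpace C(X, ℝ)]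
    (μ : Measure C(X, ℝ)) [IsProbabilityMeasure μ]
    (hμ : Integrable (fun γ : C(X, ℝ) => ‖γ‖) μ)
    (hties : ∀ f : C(X, ℝ),
      μ {γ : C(X, ℝ) | ∃ x x' : X, x ≠ x' ∧ (∀ z, (f + γ) z ≤ (f + γ) x) ∧
        (∀ z, (f + γ) z ≤ (f + γ) x')} = 0)
    (A : C(X, ℝ) → X) (hA : Measurable A)
    (hAmax : ∀ g : C(X, ℝ), ∀ x : X, g x ≤ g (A g))
    (f v : C(X, ℝ)) :
    Tendsto (fun ε : ℝ => ((∫ γ, supVal (f + ε • v + γ) ∂μ) - ∫ γ, supVal (f + γ) ∂μ) / ε)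
      (nhdsWithin 0 (Set.Ioi 0)) (nhds (∫ γ, v (A (f + γ)) ∂μ)) := by
  have hcomm (ε : ℝ) (γ : C(X, ℝ)) : f + ε • v + γ = f + γ + ε • v := add_right_comm _ _ _
  have hquot (ε : ℝ) :
      ((∫ γ, supVal (f + ε • v + γ) ∂μ) - ∫ γ, supVal (f + γ) ∂μ) / ε =
        ∫ γ, (supVal (f + ε • v + γ) - supVal (f + γ)) / ε ∂μ := by
    rw [integral_div, integral_sub (integrable_supVal_add hμ _) (integrable_supVal_add hμ _)]
  simp_rw [hquot]
  refine tendsto_integral_filter_of_dominated_convergence (fun _ => ‖v‖) ?_ ?_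
    (integrable_const _) ?_
  · exact .of_forall fun ε => (((integrable_supVal_add hμ _).sub
      (integrable_supVal_add hμ _)).div_const ε).aestronglyMeasurable
  · filter_upwards [self_mem_nhdsWithin] with ε hε
    refine .of_forall fun γ => ?_
    obtain ⟨hlow, hupp⟩ := supVal_quotient_mem_Icc hAmax (f + γ) v hε
    rw [hcomm, Real.norm_eq_abs, abs_le]
    exact ⟨(neg_le_of_abs_le (v.norm_coe_le_norm _)).trans hlow,
      hupp.trans ((le_abs_self _).trans (v.norm_coe_le_norm _))⟩
  · filter_upwards [measure_eq_zero_iff_ae_notMem.1 (hties f)] with γ hγ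
    have hA_cont : ContinuousAt A (f + γ) :=
      continuousAt_maximizer_of_unique hAmax fun y hy =>
        not_not.1 fun hne => hγ ⟨y, A (f + γ), hne, hy, hAmax _⟩
    have hpert : Tendsto (fun ε : ℝ => f + γ + ε • v) (nhdsWithin 0 (Set.Ioi 0))
        (nhds (f + γ)) := by
      have hcont : Continuous fun ε : ℝ => f + γ + ε • v := by fun_prop
      simpa using (hcont.tendsto 0).mono_left nhdsWithin_le_nhds
    refine tendsto_of_tendsto_of_tendsto_of_le_of_le' tendsto_const_nhds
      ((v.continuous.tendsto _).comp (hA_cont.tendsto.comp hpert)) ?_ ?_ <;>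
    · filter_upwards [self_mem_nhdsWithin] with ε hε
      obtain ⟨hlow, hupp⟩ := supVal_quotient_mem_Icc hAmax (f + γ) v hε
      rw [hcomm]
      first | exact hlow | exact hupp
end

section
/- Let E be a real vector space, X a nonempty set, and L : X × E → ℝ with V(θ) = sup_{x∈X} L(x,θ) finite for every θ ∈ E. Assume L is affine in its second argument, i.e. L(x,θ) = L₀(x,θ) + m(x) where L₀(x,·) : E → ℝ is linear for each x and m : X → ℝ. Fix θ, v ∈ E. Suppose x* ∈ X satisfies L(x*,θ) = V(θ), and that there is ε₀ > 0 such that for every ε ∈ (0,ε₀) there exists x*_ε ∈ X with L(x*_ε, θ+εv) = V(θ+εv) and L₀(x*_ε, v) → L₀(x*, v) as ε → 0⁺. Then the one-sided limit lim_{ε→0⁺} ( V(θ+εv) − V(θ) ) / ε exists and equals L₀(x*, v); moreover L₀(x', v) ≤ L₀(x*, v) for every x' ∈ X with L(x',θ) = V(θ). -/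
open Filter

/-- Sharp envelope theorem for affine objectives: with
`L x θ = L₀ x θ + m x` affine in `θ` (`L₀ x` linear), `V θ` the (finite) supremum of
`L · θ`, a maximizer `x*` at `θ`, and near-optimal selections `sel ε` at `θ + ε v`
whose linear values converge, the one-sided directional derivative of `V` at `θ` in
direction `v` exists and equals `L₀ x* v`; moreover `L₀ x' v ≤ L₀ x* v` for every
maximizer `x'` at `θ`. -/
theorem envelope_sharp {E X : Type*} [AddCommGroup E] [Module ℝ E] [Nonempty X]
    (L₀ : X → E →ₗ[ℝ] ℝ) (m : X → ℝ) (V : E → ℝ)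
    (hV : ∀ θ : E, IsLUB (Set.range fun x => L₀ x θ + m x) (V θ))
    (θ v : E) (xstar : X) (hx : L₀ xstar θ + m xstar = V θ)
    (ε₀ : ℝ) (hε₀ : 0 < ε₀) (sel : ℝ → X)
    (hsel : ∀ ε ∈ Set.Ioo (0:ℝ) ε₀, L₀ (sel ε) (θ + ε • v) + m (sel ε) = V (θ + ε • v))
    (hconv : Tendsto (fun ε : ℝ => L₀ (sel ε) v) (nhdsWithin 0 (Set.Ioi 0))
      (nhds (L₀ xstar v))) :
    Tendsto (fun ε : ℝ => (V (θ + ε • v) - V θ) / ε) (nhdsWithin 0 (Set.Ioi 0))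
        (nhds (L₀ xstar v)) ∧
      ∀ x' : X, L₀ x' θ + m x' = V θ → L₀ x' v ≤ L₀ xstar v := by
  have hev : ∀ᶠ ε : ℝ in nhdsWithin 0 (Set.Ioi 0), ε ∈ Set.Ioo (0 : ℝ) ε₀ :=
    Ioo_mem_nhdsGT hε₀
  have lower : ∀ x' : X, L₀ x' θ + m x' = V θ →
      ∀ ε ∈ Set.Ioo (0 : ℝ) ε₀, L₀ x' v ≤ (V (θ + ε • v) - V θ) / ε := by
    intro x' hx' ε hε
    rw [le_div_iff₀ hε.1]
    have h := (hV (θ + ε • v)).1 ⟨x', rfl⟩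
    simp only [map_add, map_smul, smul_eq_mul] at h
    linarith
  have upper : ∀ ε ∈ Set.Ioo (0 : ℝ) ε₀,
      (V (θ + ε • v) - V θ) / ε ≤ L₀ (sel ε) v := by
    intro ε hε
    rw [div_le_iff₀ hε.1, ← hsel ε hε]
    have h := (hV θ).1 ⟨sel ε, rfl⟩
    simp only [map_add, map_smul, smul_eq_mul] at h ⊢
    linarith
  refine ⟨tendsto_of_tendsto_of_tendsto_of_le_of_le' tendsto_const_nhds hconv
    (hev.mono (lower xstar hx)) (hev.mono upper), fun x' hx' => ?_⟩
  exact ge_of_tendsto hconv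
    (hev.mono fun ε hε => (lower x' hx' ε hε).trans (upper ε hε))
end

section
/- Let X be a compact metrizable topological space and let v ∈ C(X,ℝ). Then there exists a tie-breaking rule α : C(X,ℝ) → X, i.e. a map with α(f) a maximum point of f for every f ∈ C(X,ℝ), such that for every y ∈ C(X,ℝ) the variational value s ↦ v( α(y + s·v) ), as a function from ℝ to ℝ, is non-decreasing and right-continuous (and hence has left limits everywhere). In particular v( α(y + ε·v) ) → v( α(y) ) as ε → 0⁺. -/
open Filter

/-- A continuous function `f` on a nonempty compact space has a maximum point that maximizes `v`
among all maximum points of `f`. -/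
theorem ContinuousMap.exists_isMax_lex {X : Type*} [TopologicalSpace X] [CompactSpace X]
    [Nonempty X] (v f : C(X, ℝ)) :
    ∃ a : X, (∀ x, f x ≤ f a) ∧ ∀ b, (∀ x, f x ≤ f b) → v b ≤ v a := by
  obtain ⟨m, -, hm⟩ := isCompact_univ.exists_isMaxOn Set.univ_nonempty f.continuous.continuousOn
  have hclosed : IsClosed {a : X | ∀ x, f x ≤ f a} := by
    simp only [Set.ofPred_forall]
    exact isClosed_iInter fun x => isClosed_le continuous_const f.continuous
  obtain ⟨a, ha, hmax⟩ := hclosed.isCompact.exists_isMaxOn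
    ⟨m, fun x => hm (Set.mem_univ x)⟩ v.continuous.continuousOn
  exact ⟨a, ha, fun b hb => hmax hb⟩

/-- The values of `v` at maximum points of `y + s • v` increase with `s`. -/
theorem ContinuousMap.monotone_apply_isMax {X : Type*} [TopologicalSpace X] (v y : C(X, ℝ))
    {a : ℝ → X} (ha : ∀ s x, (y + s • v) x ≤ (y + s • v) (a s)) :
    Monotone fun s => v (a s) := by
  intro s t hst
  rcases hst.eq_or_lt with rfl | hlt
  · exact le_rfl
  have h₁ := ha s (a t)
  have h₂ := ha t (a s)
  simp only [ContinuousMap.add_apply, ContinuousMap.smul_apply, smul_eq_mul] at h₁ h₂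
  have h : 0 ≤ (t - s) * (v (a t) - v (a s)) := by linarith
  exact sub_nonneg.mp (nonneg_of_mul_nonneg_right h (sub_pos.mpr hlt))

/-- The largest value of `v` on the set of maximum points of `y + s • v` is upper semicontinuous
in `s`. -/
theorem ContinuousMap.isClosed_setOf_le_apply_isMax {X : Type*} [TopologicalSpace X]
    [CompactSpace X] (v y : C(X, ℝ)) {a : ℝ → X}
    (ha : ∀ s x, (y + s • v) x ≤ (y + s • v) (a s))
    (hv : ∀ s b, (∀ x, (y + s • v) x ≤ (y + s • v) b) → v b ≤ v (a s)) (c : ℝ) :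
    IsClosed {s : ℝ | c ≤ v (a s)} := by
  have hclosed : IsClosed
      {p : ℝ × X | c ≤ v p.2 ∧ ∀ x, (y + p.1 • v) x ≤ (y + p.1 • v) p.2} := by
    simp only [Set.ofPred_and, Set.ofPred_forall, ContinuousMap.add_apply,
      ContinuousMap.smul_apply, smul_eq_mul]
    exact (isClosed_le (by fun_prop) (by fun_prop)).inter
      (isClosed_iInter fun x => isClosed_le (by fun_prop) (by fun_prop))
  convert isClosedMap_fst_of_compactSpace _ hclosed using 1
  ext s
  constructor
  · exact fun hs => ⟨(s, a s), ⟨hs, ha s⟩, rfl⟩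
  · rintro ⟨⟨t, b⟩, ⟨hc, hb⟩, rfl⟩
    exact hc.trans (hv t b hb)

/-- for every `v ∈ C(X,ℝ)` there is a tie-breaking rule
`α : C(X,ℝ) → X` (i.e. `α f` is a maximum point of `f` for every `f`) such that for
every `y`, the variational value `s ↦ v(α(y + s·v))` is non-decreasing and
right-continuous (hence with left limits); in particular
`v(α(y + ε·v)) → v(α y)` as `ε → 0⁺`. -/
theorem exists_right_continuous_tiebreak {X : Type*} [TopologicalSpace X] [CompactSpace X]
    [TopologicalSpace.MetrizableSpace X] [Nonempty X] (v : C(X, ℝ)) :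
    ∃ α : C(X, ℝ) → X,
      (∀ f : C(X, ℝ), ∀ x : X, f x ≤ f (α f)) ∧
      (∀ y : C(X, ℝ), Monotone fun s : ℝ => v (α (y + s • v))) ∧
      (∀ y : C(X, ℝ), ∀ s : ℝ,
        ContinuousWithinAt (fun s : ℝ => v (α (y + s • v))) (Set.Ici s) s) ∧
      (∀ y : C(X, ℝ),
        Tendsto (fun ε : ℝ => v (α (y + ε • v))) (nhdsWithin 0 (Set.Ioi 0))
          (nhds (v (α y)))) := by
  choose α hα hv using ContinuousMap.exists_isMax_lex v
  have hmono (y : C(X, ℝ)) : Monotone fun s : ℝ => v (α (y + s • v)) :=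
    ContinuousMap.monotone_apply_isMax v y fun s => hα (y + s • v)
  have hcont (y : C(X, ℝ)) (s : ℝ) :
      ContinuousWithinAt (fun s : ℝ => v (α (y + s • v))) (Set.Ici s) s := by
    refine tendsto_order.2 ⟨fun c hc => ?_, fun c hc => ?_⟩
    · filter_upwards [self_mem_nhdsWithin] with t ht
      exact hc.trans_le (hmono y ht)
    · have hopen := (ContinuousMap.isClosed_setOf_le_apply_isMax v y
        (fun s => hα (y + s • v)) (fun s => hv (y + s • v)) c).isOpen_compl
      filter_upwards [mem_nhdsWithin_of_mem_nhds (hopen.mem_nhds (not_le.2 hc))] with t ht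
      exact not_le.1 ht
  refine ⟨α, hα, hmono, hcont, fun y => ?_⟩
  simpa using (hcont y 0).tendsto.mono_left (nhdsWithin_mono 0 Set.Ioi_subset_Ici_self)
end

section
/- Let d ≥ 1 and let β, λ, κ > 0. Let x, x' ∈ [0,1]^d and let y : [0,1]^d → ℝ satisfy |y(z)| ≤ β for all z ∈ [0,1]^d and |y(z) − y(z')| ≤ λ‖z − z'‖ for all z, z' ∈ [0,1]^d, where ‖·‖ is the Euclidean norm. Then y(x) − y(x')·exp(−‖x−x'‖/κ) ≤ ( 2β / (1 − exp(−2β/(λκ+β))) ) · ( 1 − exp(−‖x−x'‖/κ) ). -/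
/-- key Matérn-1/2 inequality for a `β`-bounded `λ`-Lipschitz function
on `[0,1]^d`. -/
theorem bounded_lipschitz_kernel_inequality (d : ℕ) (hd : 1 ≤ d) (β lam κ : ℝ)
    (hβ : 0 < β) (hlam : 0 < lam) (hκ : 0 < κ)
    (x x' : EuclideanSpace ℝ (Fin d))
    (hx : ∀ i, x i ∈ Set.Icc (0:ℝ) 1) (hx' : ∀ i, x' i ∈ Set.Icc (0:ℝ) 1)
    (y : EuclideanSpace ℝ (Fin d) → ℝ)
    (hb : ∀ z : EuclideanSpace ℝ (Fin d), (∀ i, z i ∈ Set.Icc (0:ℝ) 1) → |y z| ≤ β)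
    (hlip : ∀ z z' : EuclideanSpace ℝ (Fin d), (∀ i, z i ∈ Set.Icc (0:ℝ) 1) →
      (∀ i, z' i ∈ Set.Icc (0:ℝ) 1) → |y z - y z'| ≤ lam * ‖z - z'‖) :
    y x - y x' * Real.exp (-‖x - x'‖ / κ) ≤
      (2 * β / (1 - Real.exp (-(2 * β) / (lam * κ + β)))) *
        (1 - Real.exp (-‖x - x'‖ / κ)) := by
  have hx_le : y x ≤ β := (abs_le.mp (hb x hx)).2
  have hdiff : y x - y x' ≤ lam * ‖x - x'‖ := (abs_le.mp (hlip x x' hx hx')).2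
  obtain ⟨t, ht⟩ : ∃ t, t = ‖x - x'‖ / κ := ⟨_, rfl⟩
  have ht0 : 0 ≤ t := by rw [ht]; positivity
  have hr : ‖x - x'‖ = κ * t := by rw [ht]; field_simp
  rw [neg_div, ← ht]
  rw [hr] at hdiff
  have hL : 0 < lam * κ + β := by positivity
  have he : 0 < Real.exp (-t) := Real.exp_pos _
  have hs : 0 ≤ 1 - Real.exp (-t) := by
    have : Real.exp (-t) ≤ 1 := Real.exp_le_one_iff.mpr (by linarith)
    linarith
  have hte : t * Real.exp (-t) ≤ 1 - Real.exp (-t) := by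
    have h1 := mul_le_mul_of_nonneg_right (Real.add_one_le_exp t) he.le
    rw [← Real.exp_add, add_neg_cancel, Real.exp_zero] at h1
    linarith
  have hC : lam * κ + β ≤ 2 * β / (1 - Real.exp (-(2 * β) / (lam * κ + β))) := by
    have hneg : -(2 * β) / (lam * κ + β) < 0 := div_neg_of_neg_of_pos (by linarith) hL
    have hlt : Real.exp (-(2 * β) / (lam * κ + β)) < 1 := Real.exp_lt_one_iff.mpr hneg
    rw [le_div_iff₀ (by linarith)]
    have h1 := mul_le_mul_of_nonneg_left
      (Real.add_one_le_exp (-(2 * β) / (lam * κ + β))) hL.le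
    rw [mul_add, mul_div_cancel₀ _ hL.ne'] at h1
    linarith
  calc y x - y x' * Real.exp (-t)
      = (y x - y x') * Real.exp (-t) + y x * (1 - Real.exp (-t)) := by ring
    _ ≤ lam * (κ * t) * Real.exp (-t) + β * (1 - Real.exp (-t)) := by gcongr
    _ = lam * κ * (t * Real.exp (-t)) + β * (1 - Real.exp (-t)) := by ring
    _ ≤ lam * κ * (1 - Real.exp (-t)) + β * (1 - Real.exp (-t)) := by gcongr
    _ = (lam * κ + β) * (1 - Real.exp (-t)) := by ring
    _ ≤ _ := mul_le_mul_of_nonneg_right hC hs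
end

section
/- Let d ≥ 1 be an integer and κ > 0, ε > 0 real numbers. Then there exists a finite set S ⊆ [0,1]^d with cardinality |S| ≤ max( 1, 2^d · d^{d/2} / (κ^d · ε^{2d}) ) such that for every x ∈ [0,1]^d there is s ∈ S with 2 − 2·exp(−‖x − s‖/κ) ≤ ε², where ‖·‖ is the Euclidean norm; that is, S is an ε-cover of [0,1]^d in the kernel distance d_κ(x,x') = √(2 − 2·exp(−‖x−x'‖/κ)). -/
/-- Every point of the unit interval is within `1 / (2m)` of one of the `m` midpoints
`(k + 1/2) / m`. -/
lemma exists_fin_abs_sub_midpoint_le {m : ℕ} (hm : 0 < m) {t : ℝ} (ht : t ∈ Set.Icc (0 : ℝ) 1) :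
    ∃ k : Fin m, |t - ((k : ℕ) + 1 / 2) / m| ≤ 1 / (2 * m) := by
  have hm' : (0 : ℝ) < m := by exact_mod_cast hm
  suffices h : ∃ k : Fin m, ((k : ℕ) : ℝ) ≤ m * t ∧ m * t ≤ (k : ℕ) + 1 by
    obtain ⟨k, h₁, h₂⟩ := h
    refine ⟨k, ?_⟩
    have : t - ((k : ℕ) + 1 / 2) / m = (m * t - (k : ℕ) - 1 / 2) / m := by
      field_simp
      ring
    rw [this, abs_div, abs_of_pos hm', div_le_div_iff₀ hm' (by positivity)]
    have : |m * t - (k : ℕ) - 1 / 2| ≤ 1 / 2 := abs_le.2 ⟨by linarith, by linarith⟩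
    nlinarith
  have hnonneg : 0 ≤ m * t := mul_nonneg hm'.le ht.1
  by_cases h : ⌊m * t⌋₊ < m
  · exact ⟨⟨_, h⟩, Nat.floor_le hnonneg, (Nat.lt_floor_add_one _).le⟩
  · have hle : (m : ℝ) ≤ m * t := (Nat.le_floor_iff hnonneg).1 (not_lt.1 h)
    refine ⟨⟨m - 1, by omega⟩, ?_, ?_⟩ <;> simp only [Nat.cast_sub hm, Nat.cast_one]
    · linarith
    · nlinarith [ht.2]

/-- A vector in Euclidean space whose coordinates are bounded by `r` has norm at most `√d * r`. -/
lemma EuclideanSpace.norm_le_sqrt_card_mul {d : ℕ} {r : ℝ} (hr : 0 ≤ r)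
    (x : EuclideanSpace ℝ (Fin d)) (hx : ∀ i, |x i| ≤ r) : ‖x‖ ≤ √d * r := by
  rw [EuclideanSpace.norm_eq, ← Real.sqrt_sq hr, ← Real.sqrt_mul (Nat.cast_nonneg d)]
  refine Real.sqrt_le_sqrt ?_
  calc ∑ i, ‖x i‖ ^ 2 ≤ ∑ _i : Fin d, r ^ 2 :=
        Finset.sum_le_sum fun i _ => pow_le_pow_left₀ (norm_nonneg _) (hx i) 2
    _ = d * r ^ 2 := by simp

/-- The unit cube has a cover by `m ^ d` Euclidean balls of radius `√d / (2m)` centred in it. -/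
lemma exists_finset_cover_unit_cube (d : ℕ) {m : ℕ} (hm : 0 < m) :
    ∃ S : Finset (EuclideanSpace ℝ (Fin d)),
      (∀ s ∈ S, ∀ i, s i ∈ Set.Icc (0 : ℝ) 1) ∧ S.card ≤ m ^ d ∧
      ∀ x : EuclideanSpace ℝ (Fin d), (∀ i, x i ∈ Set.Icc (0 : ℝ) 1) →
        ∃ s ∈ S, ‖x - s‖ ≤ √d * (1 / (2 * m)) := by
  classical
  have hm' : (0 : ℝ) < m := by exact_mod_cast hm
  let c : (Fin d → Fin m) → EuclideanSpace ℝ (Fin d) :=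
    fun f => WithLp.toLp 2 fun i => (((f i : ℕ) : ℝ) + 1 / 2) / m
  refine ⟨Finset.univ.image c, ?_, ?_, fun x hx => ?_⟩
  · simp only [Finset.mem_image, Finset.mem_univ, true_and, forall_exists_index,
      forall_apply_eq_imp_iff]
    intro f i
    have : ((f i : ℕ) : ℝ) + 1 ≤ m := by exact_mod_cast (f i).isLt
    exact ⟨by positivity, (div_le_one hm').2 (by linarith)⟩
  · exact Finset.card_image_le.trans (by simp)
  · choose f hf using fun i => exists_fin_abs_sub_midpoint_le hm (hx i)
    exact ⟨c f, Finset.mem_image_of_mem _ (Finset.mem_univ _),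
      EuclideanSpace.norm_le_sqrt_card_mul (by positivity) _ hf⟩

lemma natCeil_le_max_one_two_mul (a : ℝ) : (⌈a⌉₊ : ℝ) ≤ max 1 (2 * a) := by
  rcases le_total a 1 with h | h
  · exact le_max_of_le_left (by exact_mod_cast Nat.ceil_le.2 (by simpa using h))
  · exact le_max_of_le_right (by linarith [Nat.ceil_lt_add_one (zero_le_one.trans h)])

/-- `[0,1]^d` admits an `ε`-cover in the Matérn-1/2 kernel distance
`d_κ(x,x') = √(2 − 2 exp(−‖x−x'‖/κ))` of cardinality at most
`max 1 (2^d d^{d/2} / (κ^d ε^{2d}))`. -/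
theorem matern_kernel_cover (d : ℕ) (hd : 1 ≤ d) (κ ε : ℝ) (hκ : 0 < κ) (hε : 0 < ε) :
    ∃ S : Finset (EuclideanSpace ℝ (Fin d)),
      (∀ s ∈ S, ∀ i, s i ∈ Set.Icc (0:ℝ) 1) ∧
      (S.card : ℝ) ≤ max 1 ((2:ℝ) ^ d * (d : ℝ) ^ ((d : ℝ) / 2) / (κ ^ d * ε ^ (2 * d))) ∧
      ∀ x : EuclideanSpace ℝ (Fin d), (∀ i, x i ∈ Set.Icc (0:ℝ) 1) →
        ∃ s ∈ S, 2 - 2 * Real.exp (-‖x - s‖ / κ) ≤ ε ^ 2 := by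
  have hd' : (0 : ℝ) < d := by exact_mod_cast hd
  set a : ℝ := √d / (κ * ε ^ 2) with ha
  have ha0 : 0 < a := by positivity
  have hm : 0 < ⌈a⌉₊ := Nat.ceil_pos.2 ha0
  have hm' : (0 : ℝ) < ⌈a⌉₊ := by exact_mod_cast hm
  obtain ⟨S, hS, hcard, hcover⟩ := exists_finset_cover_unit_cube d hm
  refine ⟨S, hS, ?_, fun x hx => ?_⟩
  · have hbound : (2 : ℝ) ^ d * (d : ℝ) ^ ((d : ℝ) / 2) / (κ ^ d * ε ^ (2 * d)) = (2 * a) ^ d := by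
      have hsqrt : (d : ℝ) ^ ((d : ℝ) / 2) = √d ^ d := by
        rw [Real.sqrt_eq_rpow, ← Real.rpow_natCast, ← Real.rpow_mul hd'.le]
        ring_nf
      rw [hsqrt, ha, mul_pow, div_pow, mul_pow, pow_mul, mul_div_assoc]
    have hcard' : (S.card : ℝ) ≤ (⌈a⌉₊ : ℝ) ^ d := by exact_mod_cast hcard
    rw [hbound]
    refine hcard'.trans ?_
    rcases le_max_iff.1 (natCeil_le_max_one_two_mul a) with h | h
    · exact le_max_of_le_left (pow_le_one₀ hm'.le h)
    · exact le_max_of_le_right (pow_le_pow_left₀ hm'.le h d)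
  · obtain ⟨s, hs, hxs⟩ := hcover x hx
    refine ⟨s, hs, ?_⟩
    have hexp := Real.add_one_le_exp (-‖x - s‖ / κ)
    have hsqrt : √d ≤ ⌈a⌉₊ * (κ * ε ^ 2) :=
      (div_le_iff₀ (by positivity)).1 (Nat.le_ceil a)
    have hnorm : ‖x - s‖ / κ ≤ ε ^ 2 / 2 := by
      rw [div_le_iff₀ hκ]
      refine hxs.trans ?_
      rw [mul_one_div, div_le_iff₀ (by positivity)]
      linarith
    rw [neg_div] at hexp ⊢
    linarith
end

section
/- For every real ψ > 0, letting m = min( 1/2, √(2ψ) ), the integral ∫₀^m √( log( 2ψ/ε² ) ) dε is finite and satisfies ∫₀^m √( log( 2ψ/ε² ) ) dε ≤ 2.7 · √( log(1 + ψ) ). (Note that for 0 < ε ≤ m one has 2ψ/ε² ≥ 1, so the integrand is a well-defined nonnegative real number.) -/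
lemma log_div_sq {K ε : ℝ} (hK : 0 < K) (hε : 0 < ε) :
    Real.log (K / ε ^ 2) = Real.log K - 2 * Real.log ε := by
  rw [Real.log_div hK.ne' (by positivity), Real.log_pow]
  norm_num

lemma Real.sqrt_le_half_div_add {x c : ℝ} (hx : 0 ≤ x) (hc : 0 < c) :
    √x ≤ (x / c + c) / 2 := by
  have h : x / c * c = x := div_mul_cancel₀ x hc.ne'
  refine Real.sqrt_le_iff.2 ⟨by positivity, ?_⟩
  nlinarith [sq_nonneg (x / c - c)]

/-- The mean of `√(log (K / ε²))` over `(0, m]` is at most the root of the mean of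
`log (K / ε²)`. -/
lemma sqrt_log_integral_le {K m : ℝ} (hm : 0 < m) (hmK : m ^ 2 ≤ K) :
    IntervalIntegrable (fun ε : ℝ => √(Real.log (K / ε ^ 2))) MeasureTheory.volume 0 m ∧
      ∫ ε in (0:ℝ)..m, √(Real.log (K / ε ^ 2)) ≤ m * √(Real.log (K / m ^ 2) + 2) := by
  have hK : 0 < K := lt_of_lt_of_le (by positivity) hmK
  have hlog : 0 ≤ Real.log (K / m ^ 2) :=
    Real.log_nonneg ((one_le_div (by positivity)).2 hmK)
  set c := √(Real.log (K / m ^ 2) + 2) with hc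
  have hc0 : 0 < c := Real.sqrt_pos.2 (by linarith)
  have hcc : c ^ 2 = Real.log (K / m ^ 2) + 2 := Real.sq_sqrt (by linarith)
  have hg : IntervalIntegrable (fun ε : ℝ => ((Real.log K - 2 * Real.log ε) / c + c) / 2)
      MeasureTheory.volume 0 m :=
    (((intervalIntegrable_const.sub
      (intervalIntegral.intervalIntegrable_log'.const_mul 2)).div_const c).add
      intervalIntegrable_const).div_const 2
  have hle : ∀ ε ∈ Set.Ioc 0 m,
      √(Real.log (K / ε ^ 2)) ≤ ((Real.log K - 2 * Real.log ε) / c + c) / 2 := by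
    intro ε hε
    rw [← log_div_sq hK hε.1]
    refine Real.sqrt_le_half_div_add (Real.log_nonneg ?_) hc0
    rw [one_le_div (pow_pos hε.1 2)]
    exact (pow_le_pow_left₀ hε.1.le hε.2 2).trans hmK
  have hf : IntervalIntegrable (fun ε : ℝ => √(Real.log (K / ε ^ 2)))
      MeasureTheory.volume 0 m := by
    refine hg.mono_fun' (Measurable.aestronglyMeasurable (by fun_prop)) ?_
    rw [Set.uIoc_of_le hm.le]
    filter_upwards [MeasureTheory.ae_restrict_mem measurableSet_Ioc] with ε hε
    rw [Real.norm_of_nonneg (Real.sqrt_nonneg _)]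
    exact hle ε hε
  refine ⟨hf, (intervalIntegral.integral_mono_on_of_le_Ioo hm.le hf hg
    fun ε hε => hle ε ⟨hε.1, hε.2.le⟩).trans_eq ?_⟩
  rw [intervalIntegral.integral_div, intervalIntegral.integral_add
      ((intervalIntegrable_const.sub
        (intervalIntegral.intervalIntegrable_log'.const_mul 2)).div_const c)
      intervalIntegrable_const,
    intervalIntegral.integral_div, intervalIntegral.integral_sub intervalIntegrable_const
      (intervalIntegral.intervalIntegrable_log'.const_mul 2),
    intervalIntegral.integral_const_mul, integral_log]
  simp only [intervalIntegral.integral_const, smul_eq_mul, sub_zero, zero_mul, add_zero]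
  rw [log_div_sq hK hm] at hcc
  have h : m * Real.log K - 2 * (m * Real.log m - m) = m * c ^ 2 := by rw [hcc]; ring
  rw [h]
  field_simp
  ring

lemma log_eight_mul_add_two_le {ψ : ℝ} (hψ : 1 / 8 ≤ ψ) :
    Real.log (8 * ψ) + 2 ≤ 29.16 * Real.log (1 + ψ) := by
  have hpow : 8 * ψ ≤ ((1 + ψ) / (9 / 8)) ^ 9 := by
    have := one_add_mul_le_pow (a := (1 + ψ) / (9 / 8) - 1) (by linarith) 9
    rw [add_sub_cancel] at this
    refine le_trans (le_of_eq ?_) this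
    push_cast
    ring
  have h₁ := Real.log_le_log (by linarith) hpow
  rw [Real.log_pow, Real.log_div (by linarith) (by norm_num)] at h₁
  have h₂ : Real.log (9 / 8) ≤ Real.log (1 + ψ) :=
    Real.log_le_log (by norm_num) (by linarith)
  have h₃ := Real.one_sub_inv_le_log_of_pos (show (0:ℝ) < 9 / 8 by norm_num)
  norm_num at h₁ h₃ ⊢
  linarith

/-- the Dudley entropy integral `∫₀^m √(log(2ψ/ε²)) dε`, with
`m = min (1/2) (√(2ψ))`, is finite and bounded by `2.7 √(log(1+ψ))`. -/
theorem dudley_integral_bound (ψ : ℝ) (hψ : 0 < ψ) :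
    IntervalIntegrable (fun ε : ℝ => Real.sqrt (Real.log (2 * ψ / ε ^ 2)))
        MeasureTheory.volume 0 (min (1/2) (Real.sqrt (2 * ψ))) ∧
      (∫ ε in (0:ℝ)..(min (1/2) (Real.sqrt (2 * ψ))),
          Real.sqrt (Real.log (2 * ψ / ε ^ 2)))
        ≤ 2.7 * Real.sqrt (Real.log (1 + ψ)) := by
  have hlog : 0 ≤ Real.log (1 + ψ) := Real.log_nonneg (by linarith)
  have hsq : √(2 * ψ) ^ 2 = 2 * ψ := Real.sq_sqrt (by linarith)
  have hm : 0 < min (1 / 2) √(2 * ψ) := lt_min (by norm_num) (Real.sqrt_pos.2 (by linarith))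
  have hmK : min (1 / 2) √(2 * ψ) ^ 2 ≤ 2 * ψ :=
    (pow_le_pow_left₀ hm.le (min_le_right _ _) 2).trans_eq hsq
  obtain ⟨hint, hbound⟩ := sqrt_log_integral_le hm hmK
  refine ⟨hint, hbound.trans (abs_le_of_sq_le_sq' ?_ (by positivity)).2⟩
  rw [mul_pow, mul_pow, Real.sq_sqrt hlog, Real.sq_sqrt
    (add_nonneg (Real.log_nonneg ((one_le_div (by positivity)).2 hmK)) zero_le_two)]
  rcases le_total (1 / 2) √(2 * ψ) with h | h
  · rw [min_eq_left h]
    have h8 : 1 / 8 ≤ ψ := by nlinarith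
    have := log_eight_mul_add_two_le h8
    rw [show 2 * ψ / (1 / 2) ^ 2 = 8 * ψ by ring]
    norm_num at this ⊢
    linarith
  · rw [min_eq_right h, hsq, div_self (by linarith), Real.log_one]
    have h8 : ψ ≤ 1 / 8 := by nlinarith [Real.sqrt_nonneg (2 * ψ)]
    have h₁ := Real.one_sub_inv_le_log_of_pos (show 0 < 1 + ψ by linarith)
    have h₂ : 8 / 9 * ψ ≤ 1 - (1 + ψ)⁻¹ := by
      rw [show 1 - (1 + ψ)⁻¹ = ψ / (1 + ψ) by field_simp; ring, le_div_iff₀ (by linarith)]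
      nlinarith
    norm_num
    linarith
end

section
/- Let N ≥ 2 and T ≥ 1 be integers and let y_1,…,y_T ∈ ℝ^N with ‖y_t‖∞ ≤ 1 for every t. Let (γ_{t,i})_{1≤t≤T, 1≤i≤N} be independent real Gaussian random variables, each with mean 0 and variance 2 (i.e. distributed according to the product over t,i of the Gaussian measure N(0,2) on ℝ). For 1 ≤ t ≤ T define the Thompson sampling distribution p_t on {1,…,N} by p_t(i) = ℙ( the function j ↦ Σ_{τ=1}^{t−1} y_τ(j) + Σ_{τ=t}^T γ_{τ,j} attains its maximum uniquely at j = i ); the maximum is almost surely unique, so p_t is a probability vector. Then the regret satisfies max_{1≤i≤N} Σ_{t=1}^T y_t(i) − Σ_{t=1}^T Σ_{i=1}^N p_t(i) · y_t(i) ≤ 4·√( T·log N ). -/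
open MeasureTheory Finset

/-- The Cameron–Martin formula for a centred Gaussian vector with i.i.d. coordinates of
variance `2 * n`: a translation of `ν` has the expected exponential density. -/
def HasGaussianShift {ι : Type*} [Fintype ι] (ν : Measure (ι → ℝ)) (n : ℝ) : Prop :=
  ∀ d : ι → ℝ, ν.map (· + d) = ν.withDensity fun z =>
    ENNReal.ofReal (Real.exp ((∑ i, d i * z i) / (2 * n) - (∑ i, d i ^ 2) / (4 * n)))

theorem gaussianReal_two_eq_withDensity (w : ℝ) :
    ProbabilityTheory.gaussianReal w 2 = (ProbabilityTheory.gaussianReal 0 2).withDensity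
      fun x => ENNReal.ofReal (Real.exp (w * x / 2 - w ^ 2 / 4)) := by
  rw [ProbabilityTheory.gaussianReal_of_var_ne_zero _ two_ne_zero,
    ProbabilityTheory.gaussianReal_of_var_ne_zero _ two_ne_zero,
    ← withDensity_mul _ (ProbabilityTheory.measurable_gaussianPDF _ _) (by fun_prop)]
  congr 1
  ext x
  simp only [ProbabilityTheory.gaussianPDF, Pi.mul_apply, ProbabilityTheory.gaussianPDFReal]
  rw [← ENNReal.ofReal_mul (by positivity), mul_assoc _ (Real.exp _) (Real.exp _), ← Real.exp_add]
  congr 3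
  push_cast
  ring

theorem hasGaussianShift_pi {ι : Type*} [Fintype ι] :
    HasGaussianShift (Measure.pi fun _ : ι => ProbabilityTheory.gaussianReal 0 2) 1 := by
  intro d
  have hmap : (Measure.pi fun _ : ι => ProbabilityTheory.gaussianReal 0 2).map (· + d) =
      Measure.pi fun i => ProbabilityTheory.gaussianReal (d i) 2 := by
    have h (i : ι) : (ProbabilityTheory.gaussianReal 0 2).map (· + d i) =
        ProbabilityTheory.gaussianReal (d i) 2 := by
      rw [ProbabilityTheory.gaussianReal_map_add_const, zero_add]
    have : ∀ i, SigmaFinite ((ProbabilityTheory.gaussianReal 0 2).map (· + d i)) := by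
      intro i; rw [h]; infer_instance
    simp_rw [← h]
    exact Measure.pi_map_pi (f := fun i x => x + d i) fun i => by fun_prop
  have hint (i : ι) : Integrable (fun x => Real.exp (d i * x / 2 - d i ^ 2 / 4))
      (ProbabilityTheory.gaussianReal 0 2) := by
    have := (ProbabilityTheory.integrable_exp_mul_gaussianReal (μ := 0) (v := 2) (d i / 2)).mul_const
      (Real.exp (-(d i ^ 2 / 4)))
    refine this.congr (ae_of_all _ fun x => ?_)
    simp only
    rw [← Real.exp_add]
    ring_nf
  rw [hmap]
  refine Measure.pi_eq fun s hs => ?_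
  have hprod (z : ι → ℝ) : Real.exp ((∑ i, d i * z i) / (2 * 1) - (∑ i, d i ^ 2) / (4 * 1)) =
      ∏ i, Real.exp (d i * z i / 2 - d i ^ 2 / 4) := by
    rw [← Real.exp_sum, Finset.sum_sub_distrib, Finset.sum_div, Finset.sum_div]
    norm_num
  rw [withDensity_apply _ (MeasurableSet.univ_pi hs), Measure.restrict_pi_pi]
  simp_rw [hprod]
  rw [← ofReal_integral_eq_lintegral_ofReal
      (Integrable.fintype_prod fun i => (hint i).restrict)
      (ae_of_all _ fun z => by positivity),
    integral_fintype_prod_eq_prod (fun i x => Real.exp (d i * x / 2 - d i ^ 2 / 4)),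
    ENNReal.ofReal_prod_of_nonneg fun i _ => integral_nonneg fun x => by positivity]
  refine Finset.prod_congr rfl fun i _ => ?_
  rw [gaussianReal_two_eq_withDensity (d i), withDensity_apply _ (hs i),
    ofReal_integral_eq_lintegral_ofReal (hint i).restrict (ae_of_all _ fun z => by positivity)]

theorem HasGaussianShift.map_sum {τ ι : Type*} [Fintype τ] [Fintype ι]
    {μ : Measure (τ × ι → ℝ)} (hμ : HasGaussianShift μ 1) (s : Finset τ) (hs : s.Nonempty) :
    HasGaussianShift (μ.map fun γ j => ∑ t ∈ s, γ (t, j)) s.card := by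
  classical
  intro d
  have hn : (s.card : ℝ) ≠ 0 := by exact_mod_cast hs.card_pos.ne'
  let w : τ × ι → ℝ := fun p => if p.1 ∈ s then d p.2 / s.card else 0
  have hZ : Measurable fun (γ : τ × ι → ℝ) j => ∑ t ∈ s, γ (t, j) := by fun_prop
  have hshift : (fun (γ : τ × ι → ℝ) => (fun j => ∑ t ∈ s, γ (t, j)) + d) =
      (fun γ j => ∑ t ∈ s, γ (t, j)) ∘ (· + w) := by
    ext γ j
    simp only [Function.comp, Pi.add_apply, Finset.sum_add_distrib, w]
    rw [Finset.sum_congr rfl fun t ht => if_pos ht, Finset.sum_const, nsmul_eq_mul]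
    field_simp
  have hlin (γ : τ × ι → ℝ) : ∑ p, w p * γ p = (∑ j, d j * ∑ t ∈ s, γ (t, j)) / s.card := by
    rw [Fintype.sum_prod_type_right, Finset.sum_div]
    refine Finset.sum_congr rfl fun j _ => ?_
    simp only [w, ite_mul, zero_mul, Finset.sum_ite_mem, Finset.univ_inter]
    rw [← Finset.mul_sum]
    ring
  have hsq : ∑ p, w p ^ 2 = (∑ j, d j ^ 2) / s.card := by
    rw [Fintype.sum_prod_type_right, Finset.sum_div]
    refine Finset.sum_congr rfl fun j _ => ?_
    simp only [w, ite_pow, ne_eq, OfNat.ofNat_ne_zero, not_false_eq_true, zero_pow,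
      Finset.sum_ite_mem, Finset.univ_inter, Finset.sum_const, nsmul_eq_mul]
    field_simp
  rw [Measure.map_map (by fun_prop) hZ]
  change μ.map (fun (γ : τ × ι → ℝ) => (fun j => ∑ t ∈ s, γ (t, j)) + d) = _
  rw [hshift, ← Measure.map_map hZ (by fun_prop), hμ w]
  ext E hE
  rw [Measure.map_apply hZ hE, withDensity_apply _ (hZ hE), withDensity_apply _ hE,
    setLIntegral_map hE (by fun_prop) hZ]
  simp_rw [hlin, hsq]
  refine lintegral_congr fun γ => ?_
  congr 3 <;> field_simp

namespace HasGaussianShift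

variable {ι : Type*} [Fintype ι] {ν : Measure (ι → ℝ)} {n : ℝ}

theorem measureReal_add_mem (hν : HasGaussianShift ν n) (d : ι → ℝ) {E : Set (ι → ℝ)}
    (hE : MeasurableSet E) :
    ν.real {z | z + d ∈ E} =
      ∫ z in E, Real.exp ((∑ i, d i * z i) / (2 * n) - (∑ i, d i ^ 2) / (4 * n)) ∂ν := by
  rw [integral_eq_lintegral_of_nonneg_ae (ae_of_all _ fun z => by positivity)
    (Measurable.aestronglyMeasurable (by fun_prop)), ← withDensity_apply _ hE, ← hν d, Measure.map_apply (by fun_prop) hE]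
  rfl

theorem integrable_exp [IsProbabilityMeasure ν] (hν : HasGaussianShift ν n) (hn : 0 < n)
    (d : ι → ℝ) : Integrable (fun z => Real.exp (∑ i, d i * z i)) ν := by
  have h : Integrable (fun z : ι → ℝ => Real.exp ((∑ i, ((2 * n) • d) i * z i) / (2 * n) -
      (∑ i, ((2 * n) • d) i ^ 2) / (4 * n))) ν := by
    refine ⟨Measurable.aestronglyMeasurable (by fun_prop), ?_⟩
    rw [hasFiniteIntegral_iff_ofReal (ae_of_all _ fun z => by positivity), ← setLIntegral_univ,
      ← withDensity_apply _ MeasurableSet.univ, ← hν, Measure.map_apply (by fun_prop) .univ]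
    simp
  refine (h.mul_const (Real.exp ((∑ i, ((2 * n) • d) i ^ 2) / (4 * n)))).congr
    (ae_of_all _ fun z => ?_)
  simp only
  rw [← Real.exp_add, sub_add_cancel]
  simp only [Pi.smul_apply, smul_eq_mul, mul_assoc (2 * n), ← Finset.mul_sum]
  congr 1
  field_simp

theorem integral_exp [IsProbabilityMeasure ν] (hν : HasGaussianShift ν n) (hn : 0 < n)
    (d : ι → ℝ) : ∫ z, Real.exp (∑ i, d i * z i) ∂ν = Real.exp (n * ∑ i, d i ^ 2) := by
  have h := hν.measureReal_add_mem ((2 * n) • d) MeasurableSet.univ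
  have e (z : ι → ℝ) : (∑ i, ((2 * n) • d) i * z i) / (2 * n) -
      (∑ i, ((2 * n) • d) i ^ 2) / (4 * n) = ∑ i, d i * z i - n * ∑ i, d i ^ 2 := by
    simp only [Pi.smul_apply, smul_eq_mul, mul_assoc (2 * n), mul_pow, ← Finset.mul_sum]
    field_simp
    ring
  simp only [Set.mem_univ, Set.ofPred_true, probReal_univ, setIntegral_univ, e, Real.exp_sub,
    integral_div] at h
  rwa [eq_div_iff (Real.exp_ne_zero _), one_mul, eq_comm] at h

theorem integrable_apply [IsProbabilityMeasure ν] (hν : HasGaussianShift ν n) (hn : 0 < n)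
    (i : ι) : Integrable (fun z => z i) ν := by
  classical
  have h1 := hν.integrable_exp hn (Pi.single i 1)
  have h2 := hν.integrable_exp hn (Pi.single i (-1))
  simp only [Pi.single_apply, ite_mul, one_mul, zero_mul, neg_mul, Finset.sum_ite_eq',
    Finset.mem_univ, if_true] at h1 h2
  refine (h1.add h2).mono' (measurable_pi_apply i).aestronglyMeasurable (ae_of_all _ fun z => ?_)
  rw [Real.norm_eq_abs, Pi.add_apply, abs_le]
  have := Real.add_one_le_exp (z i)
  have := Real.add_one_le_exp (-z i)
  have := Real.exp_pos (z i)
  have := Real.exp_pos (-z i)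
  constructor <;> linarith

theorem hasDerivAt_measureReal [IsProbabilityMeasure ν] (hν : HasGaussianShift ν n) (hn : 0 < n)
    (d : ι → ℝ) {E : Set (ι → ℝ)} (hE : MeasurableSet E) :
    HasDerivAt (fun u : ℝ => ν.real {z | z + u • d ∈ E})
      ((∑ i, d i * ∫ z in E, z i ∂ν) / (2 * n)) 0 := by
  let a : (ι → ℝ) → ℝ := fun z => (∑ i, d i * z i) / (2 * n)
  have hset : ProbabilityTheory.integrableExpSet a (ν.restrict E) = Set.univ := by
    refine Set.eq_univ_of_forall fun u => ?_
    have := (hν.integrable_exp hn ((u / (2 * n)) • d)).restrict (s := E)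
    refine this.congr (ae_of_all _ fun z => ?_)
    simp only [a, Pi.smul_apply, smul_eq_mul, mul_assoc, ← Finset.mul_sum]
    ring_nf
  have hmgf := ProbabilityTheory.hasDerivAt_mgf (X := a) (μ := ν.restrict E) (t := 0)
    (by simp [hset])
  have hexp : HasDerivAt (fun u : ℝ => Real.exp (-(u ^ 2 * (∑ i, d i ^ 2) / (4 * n)))) 0 0 := by
    have := ((((hasDerivAt_id (0 : ℝ)).pow 2).mul_const (∑ i, d i ^ 2)).div_const (4 * n)).neg.exp
    simpa using this
  have hfun : (fun u : ℝ => ν.real {z | z + u • d ∈ E}) = fun u =>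
      Real.exp (-(u ^ 2 * (∑ i, d i ^ 2) / (4 * n))) *
        ProbabilityTheory.mgf a (ν.restrict E) u := by
    ext u
    rw [hν.measureReal_add_mem (u • d) hE, ProbabilityTheory.mgf, ← integral_const_mul]
    refine integral_congr_ae (ae_of_all _ fun z => ?_)
    simp only [a, Pi.smul_apply, smul_eq_mul, mul_assoc, mul_pow, ← Finset.mul_sum]
    rw [← Real.exp_add]
    ring_nf
  rw [hfun]
  convert! hexp.mul hmgf using 1
  simp only [zero_mul, Real.exp_zero, mul_one, a, integral_div, zero_add]
  rw [integral_finsetSum _ fun i _ => ((hν.integrable_apply hn i).const_mul _).restrict]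
  simp [integral_const_mul]

theorem measure_sub_eq_const [IsProbabilityMeasure ν] (hν : HasGaussianShift ν n)
    {i j : ι} (hij : i ≠ j) (c : ℝ) : ν {z | z i - z j = c} = 0 := by
  classical
  have hcount := Measure.countable_meas_level_set_pos (μ := ν)
    (g := fun z : ι → ℝ => z i - z j) (by fun_prop)
  obtain ⟨b, hb⟩ : ∃ b, b ∉ {t : ℝ | 0 < ν {z | z i - z j = t}} := by
    by_contra! h
    exact Cardinal.not_countable_real (hcount.mono fun x _ => h x)
  have hb0 : ν {z | z i - z j = b} = 0 := by simpa using hb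
  have hmeas : MeasurableSet {z : ι → ℝ | z i - z j = b} :=
    measurableSet_eq_fun (by fun_prop) (by fun_prop)
  have h : ν.map (· + Pi.single i (b - c)) {z | z i - z j = b} = 0 := by
    rw [hν]
    exact withDensity_absolutelyContinuous _ _ hb0
  rw [Measure.map_apply (by fun_prop) hmeas] at h
  convert h using 2
  ext z
  simp only [Set.mem_ofPred_eq, Set.mem_preimage, Pi.add_apply, Pi.single_eq_same,
    Pi.single_eq_of_ne hij.symm]
  constructor <;> intro h <;> linarith

end HasGaussianShift

/-- The set of perturbations `z` under which coordinate `k` of `x + z` is the unique maximum. -/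
def leaderSet {ι : Type*} (x : ι → ℝ) (k : ι) : Set (ι → ℝ) :=
  {z | ∀ j, j ≠ k → x j + z j < x k + z k}

theorem measurableSet_leaderSet {ι : Type*} [Fintype ι] (x : ι → ℝ) (k : ι) :
    MeasurableSet (leaderSet x k) := by
  simp only [leaderSet, Set.ofPred_forall]
  exact .iInter fun j => .iInter fun _ => measurableSet_lt (by fun_prop) (by fun_prop)

theorem pairwise_disjoint_leaderSet {ι : Type*} (x : ι → ℝ) :
    Pairwise (Function.onFun Disjoint (leaderSet x)) := fun i j hij =>
  Set.disjoint_left.2 fun _ hi hj => lt_asymm (hi j hij.symm) (hj i hij)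

theorem setOf_add_smul_mem_leaderSet {ι : Type*} (x d : ι → ℝ) (u : ℝ) (k : ι) :
    {z | z + u • d ∈ leaderSet x k} = leaderSet (x + u • d) k := by
  ext z
  simp [leaderSet, add_assoc, add_comm (z _)]

theorem integrable_iSup {ι Ω : Type*} [Fintype ι] [Nonempty ι] [MeasurableSpace Ω]
    {μ : Measure Ω} {f : ι → Ω → ℝ} (hm : ∀ i, Measurable (f i)) (hf : ∀ i, Integrable (f i) μ) :
    Integrable (fun ω => ⨆ i, f i ω) μ := by
  refine (integrable_finsetSum Finset.univ fun i _ => (hf i).norm).mono'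
    (Measurable.iSup hm).aestronglyMeasurable (ae_of_all _ fun ω => ?_)
  obtain ⟨i, hi⟩ := exists_eq_ciSup_of_finite (f := fun i => f i ω)
  rw [← hi]
  exact Finset.single_le_sum (f := fun i => ‖f i ω‖) (fun _ _ => norm_nonneg _) (Finset.mem_univ i)

/-- The Gaussian smoothing of the maximum. -/
noncomputable def smoothMax {ι : Type*} [Fintype ι] (ν : Measure (ι → ℝ)) (x : ι → ℝ) : ℝ :=
  ∫ z, ⨆ i, (x i + z i) ∂ν

theorem sub_le_add_of_subgradient {g q : ℝ → ℝ} {C : ℝ}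
    (hg : ∀ a b, a ≤ b → g b - g a ≤ (b - a) * q b)
    (hq : ∀ s, 0 ≤ s → q s ≤ q 0 + 2 * C * s) : g 1 - g 0 ≤ q 0 + C := by
  have step (m : ℕ) (hm : 0 < m) (k : ℕ) :
      g (k / m) - g 0 ≤ k / m * q 0 + C * (k * (k + 1)) / m ^ 2 := by
    have hm' : (0 : ℝ) < m := by exact_mod_cast hm
    induction k with
    | zero => simp
    | succ k ih =>
      have h1 := hg (k / m) ((k + 1 : ℕ) / m) (by gcongr; simp)
      have h2 := hq ((k + 1 : ℕ) / m) (by positivity)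
      have e : ((k + 1 : ℕ) / m - k / m : ℝ) = 1 / m := by push_cast; ring
      rw [e] at h1
      have h3 := mul_le_mul_of_nonneg_left h2 (by positivity : (0 : ℝ) ≤ 1 / m)
      have h4 : (1 / m : ℝ) * (q 0 + 2 * C * ((k + 1 : ℕ) / m)) + (k / m * q 0 +
          C * (k * (k + 1)) / m ^ 2) = (k + 1 : ℕ) / m * q 0 +
          C * ((k + 1 : ℕ) * ((k + 1 : ℕ) + 1)) / m ^ 2 := by
        push_cast
        field_simp
        ring
      linarith
  have hlim : Filter.Tendsto (fun m : ℕ => q 0 + C + C / (m : ℝ)) Filter.atTop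
      (nhds (q 0 + C + 0)) :=
    tendsto_const_nhds.add (tendsto_const_div_atTop_nhds_zero_nat C)
  rw [add_zero] at hlim
  refine ge_of_tendsto hlim (Filter.eventually_atTop.2 ⟨1, fun m hm => ?_⟩)
  have hm' : (m : ℝ) ≠ 0 := by positivity
  have h := step m hm m
  rw [div_self hm'] at h
  convert! h using 1
  field_simp
  ring

namespace HasGaussianShift

variable {ι : Type*} [Fintype ι] {ν : Measure (ι → ℝ)} [IsProbabilityMeasure ν] {n : ℝ}

theorem integrable_add_apply (hν : HasGaussianShift ν n) (hn : 0 < n) (x : ι → ℝ) (i : ι) :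
    Integrable (fun z => x i + z i) ν :=
  (integrable_const _).add (hν.integrable_apply hn i)

theorem sum_setIntegral_leaderSet [Nonempty ι] (hν : HasGaussianShift ν n) (x : ι → ℝ)
    {f : (ι → ℝ) → ℝ} (hf : Integrable f ν) :
    ∑ k, ∫ z in leaderSet x k, f z ∂ν = ∫ z, f z ∂ν := by
  rw [← integral_iUnion_fintype (measurableSet_leaderSet x) (pairwise_disjoint_leaderSet x)
    fun _ => hf.integrableOn]
  refine setIntegral_eq_integral_of_ae_compl_eq_zero ?_
  have hne : ∀ᵐ z ∂ν, ∀ i j : ι, i ≠ j → z i - z j ≠ x j - x i := by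
    simp only [ae_all_iff]
    intro i j hij
    rw [ae_iff]
    simpa using hν.measure_sub_eq_const hij (x j - x i)
  filter_upwards [hne] with z hz hzU
  obtain ⟨k, hk⟩ := Finite.exists_max fun i => x i + z i
  have hzk : z ∈ leaderSet x k := fun j hj =>
    lt_of_le_of_ne (hk j) fun h => hz j k hj (by linarith)
  exact absurd (Set.mem_iUnion.2 ⟨k, hzk⟩) hzU

theorem smoothMax_zero_le (hν : HasGaussianShift ν n) (hn : 0 < n) (hι : 2 ≤ Fintype.card ι) :
    smoothMax ν 0 ≤ 2 * √(n * Real.log (Fintype.card ι)) := by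
  classical
  have : Nonempty ι := Fintype.card_pos_iff.1 (by omega)
  set L := Real.log (Fintype.card ι) with hL
  have hcard : (0 : ℝ) < Fintype.card ι := by positivity
  have hLpos : 0 < L := Real.log_pos (by exact_mod_cast hι)
  set r := √(n * L) with hr
  have hrpos : 0 < r := Real.sqrt_pos.2 (by positivity)
  have hrsq : r ^ 2 = n * L := Real.sq_sqrt (by positivity)
  have hexp (i : ι) : Integrable (fun z => Real.exp (r / n * z i)) ν := by
    simpa [Pi.single_apply] using hν.integrable_exp hn (Pi.single i (r / n))
  have hexpval (i : ι) : ∫ z, Real.exp (r / n * z i) ∂ν = Real.exp L := by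
    have := hν.integral_exp hn (Pi.single i (r / n))
    simp only [Pi.single_apply, ite_mul, zero_mul, ite_pow, ne_eq, OfNat.ofNat_ne_zero,
      not_false_eq_true, zero_pow, Finset.sum_ite_eq', Finset.mem_univ, if_true] at this
    rw [this, div_pow, hrsq]
    congr 1
    field_simp
  have hle : ∫ z, r / n * ⨆ i, z i ∂ν ≤
      ∫ z, (2 * L - 1 + (∑ i, Real.exp (r / n * z i)) * Real.exp (-(2 * L))) ∂ν := by
    refine integral_mono
      ((integrable_iSup measurable_pi_apply (hν.integrable_apply hn)).const_mul _)
      ((integrable_const _).add ((integrable_finsetSum _ fun i _ => hexp i).mul_const _))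
      fun z => ?_
    obtain ⟨k, hk⟩ := exists_eq_ciSup_of_finite (f := fun i => z i)
    simp only
    rw [← hk]
    have h1 := Real.add_one_le_exp (r / n * z k + -(2 * L))
    have h2 := Finset.single_le_sum (f := fun i => Real.exp (r / n * z i))
      (fun _ _ => (Real.exp_pos _).le) (Finset.mem_univ k)
    rw [Real.exp_add] at h1
    have h3 := mul_le_mul_of_nonneg_right h2 (Real.exp_pos (-(2 * L))).le
    linarith
  rw [integral_const_mul, integral_add (integrable_const _)
    ((integrable_finsetSum _ fun i _ => hexp i).mul_const _), integral_mul_const,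
    integral_finsetSum _ fun i _ => hexp i] at hle
  simp only [hexpval, integral_const, probReal_univ, one_smul, Finset.sum_const, nsmul_eq_mul,
    Finset.card_univ] at hle
  have hone : (Fintype.card ι : ℝ) * Real.exp L * Real.exp (-(2 * L)) = 1 := by
    rw [← Real.exp_log hcard, ← hL, ← Real.exp_add, ← Real.exp_add]
    ring_nf
    simp
  rw [hone, div_mul_eq_mul_div, div_le_iff₀ hn] at hle
  simp only [smoothMax, Pi.zero_apply, zero_add]
  refine le_of_mul_le_mul_left ?_ hrpos
  nlinarith

theorem smoothMax_sub_le [Nonempty ι] (hν : HasGaussianShift ν n) (hn : 0 < n) (x x' : ι → ℝ) :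
    smoothMax ν x - smoothMax ν x' ≤ ∑ k, (x k - x' k) * ν.real (leaderSet x k) := by
  have hi (x : ι → ℝ) : Integrable (fun z : ι → ℝ => ⨆ i, (x i + z i)) ν :=
    integrable_iSup (fun i => by fun_prop) (hν.integrable_add_apply hn x)
  rw [smoothMax, smoothMax, ← integral_sub (hi x) (hi x'),
    ← hν.sum_setIntegral_leaderSet x (f := fun z => (⨆ i, (x i + z i)) - ⨆ i, (x' i + z i))
      ((hi x).sub (hi x'))]
  refine Finset.sum_le_sum fun k _ => ?_
  calc ∫ z in leaderSet x k, ((⨆ i, (x i + z i)) - ⨆ i, (x' i + z i)) ∂ν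
      ≤ ∫ z in leaderSet x k, (x k - x' k) ∂ν := by
        refine setIntegral_mono_on ((hi x).sub (hi x')).integrableOn
          (integrable_const _).integrableOn (measurableSet_leaderSet x k) fun z hz => ?_
        have h1 : (⨆ i, (x i + z i)) ≤ x k + z k := ciSup_le fun j => by
          rcases eq_or_ne j k with rfl | hj
          · exact le_rfl
          · exact (hz j hj).le
        have h2 := le_ciSup (Set.finite_range fun i => x' i + z i).bddAbove k
        linarith
    _ = (x k - x' k) * ν.real (leaderSet x k) := by
        rw [setIntegral_const, smul_eq_mul, mul_comm]

theorem setIntegral_leaderSet_nonpos (hν : HasGaussianShift ν n) (hn : 0 < n) (x : ι → ℝ)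
    {j k : ι} (hjk : j ≠ k) : ∫ z in leaderSet x k, z j ∂ν ≤ 0 := by
  classical
  have h := hν.hasDerivAt_measureReal hn (Pi.single j 1) (measurableSet_leaderSet x k)
  have hanti : Antitone fun u : ℝ =>
      ν.real {z | z + u • (Pi.single j 1 : ι → ℝ) ∈ leaderSet x k} := by
    intro u v huv
    refine measureReal_mono fun z hz i hik => ?_
    have hi := hz i hik
    simp only [Pi.add_apply, Pi.smul_apply, Pi.single_apply, smul_eq_mul, mul_ite, mul_one,
      mul_zero, if_neg hjk.symm] at hi ⊢
    split_ifs at hi ⊢ <;> linarith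
  have := h.deriv ▸ hanti.deriv_nonpos (x := 0)
  simp only [Pi.single_apply, ite_mul, one_mul, zero_mul, Finset.sum_ite_eq', Finset.mem_univ,
    if_true] at this
  rwa [div_le_iff₀ (by positivity), zero_mul] at this

theorem sum_setIntegral_leaderSet_apply (hν : HasGaussianShift ν n) (hn : 0 < n) (x : ι → ℝ)
    (k : ι) : ∑ j, ∫ z in leaderSet x k, z j ∂ν = 0 := by
  have h := hν.hasDerivAt_measureReal hn 1 (measurableSet_leaderSet x k)
  have hconst : (fun u : ℝ => ν.real {z | z + u • (1 : ι → ℝ) ∈ leaderSet x k}) =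
      fun _ => ν.real (leaderSet x k) := by
    ext u
    simp [leaderSet, ← add_assoc]
  rw [hconst] at h
  have := h.unique (hasDerivAt_const 0 _)
  simpa [hn.ne'] using this

theorem sum_mul_setIntegral_le [Nonempty ι] (hν : HasGaussianShift ν n) (hn : 0 < n)
    (x y : ι → ℝ) (hy : ∀ i, |y i| ≤ 1) :
    ∑ k, y k * ∑ j, y j * ∫ z in leaderSet x k, z j ∂ν ≤ 2 * smoothMax ν 0 := by
  classical
  have hdiag : ∑ k, ∫ z in leaderSet x k, z k ∂ν ≤ smoothMax ν 0 := by
    have hi : Integrable (fun z : ι → ℝ => ⨆ i, z i) ν :=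
      integrable_iSup measurable_pi_apply (hν.integrable_apply hn)
    simp only [smoothMax, Pi.zero_apply, zero_add]
    rw [← hν.sum_setIntegral_leaderSet x hi]
    exact Finset.sum_le_sum fun k _ => setIntegral_mono (hν.integrable_apply hn k).integrableOn
      hi.integrableOn fun z => le_ciSup (Set.finite_range fun i => z i).bddAbove k
  refine le_trans ?_ (mul_le_mul_of_nonneg_left hdiag zero_le_two)
  rw [Finset.mul_sum]
  refine Finset.sum_le_sum fun k _ => ?_
  set H : ι → ℝ := fun j => ∫ z in leaderSet x k, z j ∂ν with hH
  have hsum : ∑ j, H j = 0 := hν.sum_setIntegral_leaderSet_apply hn x k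
  have hoff (j : ι) (hj : j ≠ k) : H j ≤ 0 := hν.setIntegral_leaderSet_nonpos hn x hj
  have hkk : 0 ≤ H k := by
    rw [← Finset.add_sum_erase _ _ (Finset.mem_univ k)] at hsum
    have := Finset.sum_nonpos fun j (hj : j ∈ Finset.univ.erase k) =>
      hoff j (Finset.ne_of_mem_erase hj)
    linarith
  have habs (j : ι) : y k * (y j * H j) ≤ (if j = k then 2 * H k else 0) - H j := by
    have h1 : |y k * y j| ≤ 1 := by
      rw [abs_mul]
      exact mul_le_one₀ (hy k) (abs_nonneg _) (hy j)
    have h2 := abs_le.1 h1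
    rw [← mul_assoc]
    split_ifs with hj
    · subst hj
      nlinarith
    · nlinarith [hoff j hj]
  calc y k * ∑ j, y j * H j = ∑ j, y k * (y j * H j) := Finset.mul_sum _ _ _
    _ ≤ ∑ j, ((if j = k then 2 * H k else 0) - H j) := Finset.sum_le_sum fun j _ => habs j
    _ = 2 * H k := by simp [hsum]

theorem hasDerivAt_sum_mul_measureReal (hν : HasGaussianShift ν n) (hn : 0 < n)
    (x y : ι → ℝ) (s : ℝ) :
    HasDerivAt (fun s : ℝ => ∑ k, y k * ν.real (leaderSet (x + s • y) k))
      ((∑ k, y k * ∑ j, y j * ∫ z in leaderSet (x + s • y) k, z j ∂ν) / (2 * n)) s := by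
  rw [Finset.sum_div]
  refine HasDerivAt.fun_sum fun k _ => ?_
  rw [mul_div_assoc]
  refine HasDerivAt.const_mul _ ?_
  have h := hν.hasDerivAt_measureReal hn y (measurableSet_leaderSet (x + s • y) k)
  rw [← sub_self s] at h
  have h' := h.comp_sub_const s s
  simpa only [setOf_add_smul_mem_leaderSet, add_assoc, ← add_smul, add_sub_cancel] using h'

theorem smoothMax_add_le (hν : HasGaussianShift ν n) (hn : 0 < n) (hι : 2 ≤ Fintype.card ι)
    (x y : ι → ℝ) (hy : ∀ i, |y i| ≤ 1) :
    smoothMax ν (x + y) ≤ smoothMax ν x + ∑ k, ν.real (leaderSet x k) * y k +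
      √(Real.log (Fintype.card ι)) / √n := by
  have : Nonempty ι := Fintype.card_pos_iff.1 (by omega)
  set q : ℝ → ℝ := fun s => ∑ k, y k * ν.real (leaderSet (x + s • y) k) with hq
  have hderiv := hν.hasDerivAt_sum_mul_measureReal hn x y
  have h := sub_le_add_of_subgradient (g := fun s => smoothMax ν (x + s • y)) (q := q)
    (C := √(Real.log (Fintype.card ι)) / √n) (fun a b _ => ?_) (fun s hs => ?_)
  · simp only [hq, one_smul, zero_smul, add_zero, mul_comm (y _)] at h
    linarith
  · refine (hν.smoothMax_sub_le hn _ _).trans_eq ?_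
    simp only [hq, Finset.mul_sum, Pi.add_apply, Pi.smul_apply, smul_eq_mul]
    exact Finset.sum_congr rfl fun k _ => by ring
  · have := image_sub_le_mul_sub_of_deriv_le (f := q)
      (C := 2 * (√(Real.log (Fintype.card ι)) / √n)) (fun s => (hderiv s).differentiableAt)
      (fun s => ?_) hs
    · linarith
    · rw [(hderiv s).deriv, div_le_iff₀ (by positivity)]
      refine (hν.sum_mul_setIntegral_le hn _ y hy).trans ?_
      have := hν.smoothMax_zero_le hn hι
      rw [Real.sqrt_mul hn.le] at this
      have hs : √n * √n = n := Real.mul_self_sqrt hn.le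
      have hs0 : √n ≠ 0 := (Real.sqrt_pos.2 hn).ne'
      have e : 2 * (√(Real.log (Fintype.card ι)) / √n) * (2 * n) =
          4 * (√n * √(Real.log (Fintype.card ι))) := by
        field_simp
        rw [Real.sq_sqrt hn.le]
        ring
      linarith

end HasGaussianShift

theorem smoothMax_map_sum_le_insert {τ ι : Type*} [Fintype τ] [Fintype ι] [DecidableEq τ]
    [Nonempty ι] {s : Finset τ} {a : τ} (ha : a ∉ s) (x : ι → ℝ) :
    let μ : Measure (τ × ι → ℝ) := Measure.pi fun _ => ProbabilityTheory.gaussianReal 0 2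
    smoothMax (μ.map fun γ j => ∑ t ∈ s, γ (t, j)) x ≤
      smoothMax (μ.map fun γ j => ∑ t ∈ insert a s, γ (t, j)) x := by
  intro μ
  have hmap (s : Finset τ) : smoothMax (μ.map fun γ j => ∑ t ∈ s, γ (t, j)) x =
      ∫ γ, ⨆ i, (x i + ∑ t ∈ s, γ (t, i)) ∂μ :=
    integral_map (φ := fun (γ : τ × ι → ℝ) j => ∑ t ∈ s, γ (t, j))
      (Measurable.aemeasurable (by fun_prop))
      (Measurable.aestronglyMeasurable (by fun_prop))
  have hint (s : Finset τ) : Integrable (fun γ => ⨆ i, (x i + ∑ t ∈ s, γ (t, i))) μ :=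
    integrable_iSup (fun i => by fun_prop) fun i => (integrable_const _).add
      (integrable_finsetSum _ fun t _ => hasGaussianShift_pi.integrable_apply one_pos (t, i))
  let flip : (τ × ι → ℝ) → τ × ι → ℝ := fun γ p => (if p.1 = a then fun r => -r else id) (γ p)
  have hflip : MeasurePreserving flip μ μ := by
    refine measurePreserving_pi _ _ fun p => ?_
    split_ifs
    · exact ⟨measurable_neg, by
        simpa using ProbabilityTheory.gaussianReal_map_neg (μ := 0) (v := 2)⟩
    · exact .id _
  have hflip_int : Integrable (fun γ => ⨆ i, (x i + ∑ t ∈ insert a s, flip γ (t, i))) μ :=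
    hflip.integrable_comp_of_integrable (hint (insert a s))
  have hflip_eq : ∫ γ, ⨆ i, (x i + ∑ t ∈ insert a s, flip γ (t, i)) ∂μ =
      ∫ γ, ⨆ i, (x i + ∑ t ∈ insert a s, γ (t, i)) ∂μ := by
    rw [← integral_map (φ := flip) (f := fun γ => ⨆ i, (x i + ∑ t ∈ insert a s, γ (t, i)))
      hflip.aemeasurable (Measurable.aestronglyMeasurable (by fun_prop)), hflip.map_eq]
  have hle : ∫ γ, ⨆ i, (x i + ∑ t ∈ s, γ (t, i)) ∂μ ≤
      ∫ γ, ((⨆ i, (x i + ∑ t ∈ insert a s, γ (t, i))) +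
        ⨆ i, (x i + ∑ t ∈ insert a s, flip γ (t, i))) / 2 ∂μ := by
    refine integral_mono (hint s) (((hint _).add hflip_int).div_const 2) fun γ => ?_
    refine ciSup_le fun i => ?_
    have h1 := le_ciSup
      (Set.finite_range fun i => x i + ∑ t ∈ insert a s, γ (t, i)).bddAbove i
    have h2 := le_ciSup
      (Set.finite_range fun i => x i + ∑ t ∈ insert a s, flip γ (t, i)).bddAbove i
    have h3 : ∑ t ∈ s, flip γ (t, i) = ∑ t ∈ s, γ (t, i) :=
      Finset.sum_congr rfl fun t ht => by simp [flip, ne_of_mem_of_not_mem ht ha]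
    have h4 : flip γ (a, i) = -γ (a, i) := by simp [flip]
    simp only [Finset.sum_insert ha, h3, h4] at h1 h2 ⊢
    linarith
  rw [integral_div, integral_add (hint _) hflip_int, hflip_eq] at hle
  rw [hmap, hmap]
  linarith

theorem sum_one_div_sqrt_sub_le (T : ℕ) :
    ∑ t : Fin T, 1 / √((T : ℝ) - (t : ℕ)) ≤ 2 * √T := by
  have hstep (t : Fin T) : 1 / √((T : ℝ) - (t : ℕ)) ≤
      2 * √((T : ℝ) - (t : ℕ)) - 2 * √((T : ℝ) - ((t : ℕ) + 1 : ℕ)) := by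
    have ht : ((t : ℕ) : ℝ) + 1 ≤ T := by exact_mod_cast t.2
    have hpos : 0 < √((T : ℝ) - (t : ℕ)) := Real.sqrt_pos.2 (by linarith)
    rw [div_le_iff₀ hpos]
    have h1 := Real.sq_sqrt (show 0 ≤ (T : ℝ) - (t : ℕ) by linarith)
    have h2 := Real.sq_sqrt (show 0 ≤ (T : ℝ) - ((t : ℕ) + 1 : ℕ) by push_cast; linarith)
    have h3 := sq_nonneg (√((T : ℝ) - (t : ℕ)) - √((T : ℝ) - ((t : ℕ) + 1 : ℕ)))
    push_cast at h2 h3 ⊢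
    nlinarith
  refine (Finset.sum_le_sum fun t _ => hstep t).trans_eq ?_
  rw [Fin.sum_univ_eq_sum_range
      (fun t => 2 * √((T : ℝ) - t) - 2 * √((T : ℝ) - (t + 1 : ℕ))) T,
    Finset.sum_range_sub' (fun t : ℕ => 2 * √((T : ℝ) - t))]
  simp

/-- Thompson sampling over `N ≥ 2` experts with an i.i.d. `N(0,2)` Gaussian
prior over each future reward achieves regret at most `4√(T log N)` against reward
vectors in the `ℓ^∞` unit ball. At round `t` (rounds indexed `0, …, T−1`), expert `i`
is played with the probability that `j ↦ Σ_{τ < t} y_τ(j) + Σ_{τ ≥ t} γ_{τ,j}` attains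
its maximum uniquely at `j = i`, where `γ` is drawn from the product of `N(0,2)`
Gaussians. -/
theorem thompson_sampling_discrete_regret (N T : ℕ) (hN : 2 ≤ N) (hT : 1 ≤ T)
    (y : Fin T → Fin N → ℝ) (hy : ∀ t i, |y t i| ≤ 1) :
    let μ : Measure ((Fin T × Fin N) → ℝ) :=
      Measure.pi fun _ : Fin T × Fin N => ProbabilityTheory.gaussianReal 0 2
    let score : Fin T → ((Fin T × Fin N) → ℝ) → Fin N → ℝ := fun t γ j =>
      (∑ τ ∈ Finset.univ.filter (fun τ : Fin T => (τ : ℕ) < (t : ℕ)), y τ j) +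
        ∑ τ ∈ Finset.univ.filter (fun τ : Fin T => (t : ℕ) ≤ (τ : ℕ)), γ (τ, j)
    let p : Fin T → Fin N → ℝ := fun t i =>
      (μ {γ : (Fin T × Fin N) → ℝ | ∀ j : Fin N, j ≠ i → score t γ j < score t γ i}).toReal
    (⨆ i : Fin N, ∑ t, y t i) - ∑ t : Fin T, ∑ i : Fin N, p t i * y t i
      ≤ 4 * Real.sqrt (T * Real.log N) := by
  intro μ score p
  have : Nonempty (Fin N) := ⟨⟨0, by omega⟩⟩
  have hcard : 2 ≤ Fintype.card (Fin N) := by simpa using hN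
  set L := Real.log N with hL
  let S : ℕ → Finset (Fin T) := fun t => Finset.univ.filter fun τ : Fin T => t ≤ (τ : ℕ)
  let Y : ℕ → Fin N → ℝ := fun t j =>
    ∑ τ ∈ Finset.univ.filter (fun τ : Fin T => (τ : ℕ) < t), y τ j
  let ν : ℕ → Measure (Fin N → ℝ) := fun t => μ.map fun γ j => ∑ τ ∈ S t, γ (τ, j)
  have hmeas (t : ℕ) : Measurable fun (γ : Fin T × Fin N → ℝ) j => ∑ τ ∈ S t, γ (τ, j) := by
    fun_prop
  have hprob (t : ℕ) : IsProbabilityMeasure (ν t) :=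
    Measure.isProbabilityMeasure_map (hmeas t).aemeasurable
  have hScard (t : Fin T) : ((S t).card : ℝ) = (T : ℝ) - (t : ℕ) := by
    have : S t = Finset.Ici t := by ext τ; simp [S]
    rw [this, Fin.card_Ici, Nat.cast_sub t.2.le]
  have hpos (t : Fin T) : 0 < (T : ℝ) - (t : ℕ) := sub_pos.2 (by exact_mod_cast t.2)
  have hν (t : Fin T) : HasGaussianShift (ν t) ((T : ℝ) - (t : ℕ)) := by
    rw [← hScard]
    exact hasGaussianShift_pi.map_sum (S t) ⟨t, by simp [S]⟩
  have hp (t : Fin T) (i : Fin N) : (ν t).real (leaderSet (Y t) i) = p t i :=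
    congrArg ENNReal.toReal (Measure.map_apply (hmeas t) (measurableSet_leaderSet _ _))
  have hY (t : Fin T) : Y ((t : ℕ) + 1) = Y t + y t := by
    ext j
    have : (Finset.univ.filter fun τ : Fin T => (τ : ℕ) < (t : ℕ) + 1) =
        insert t (Finset.univ.filter fun τ : Fin T => (τ : ℕ) < (t : ℕ)) := by
      ext τ
      simp [Fin.ext_iff]
      omega
    simp only [Y, this, Pi.add_apply]
    rw [Finset.sum_insert (by simp), add_comm]
  have hS (t : Fin T) : S t = insert t (S ((t : ℕ) + 1)) := by
    ext τ
    simp [S, Fin.ext_iff]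
    omega
  have hstep (t : Fin T) : smoothMax (ν ((t : ℕ) + 1)) (Y ((t : ℕ) + 1)) - smoothMax (ν t) (Y t) ≤
      ∑ i, p t i * y t i + √L * (1 / √((T : ℝ) - (t : ℕ))) := by
    have h1 := smoothMax_map_sum_le_insert (s := S ((t : ℕ) + 1)) (a := t) (by simp [S])
      (Y ((t : ℕ) + 1))
    rw [← hS] at h1
    have h2 := (hν t).smoothMax_add_le (hpos t) hcard (Y t) (y t) (hy t)
    rw [← hY, Fintype.card_fin, ← hL] at h2
    simp only [hp] at h2
    rw [mul_one_div]
    linarith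
  have htel := Finset.sum_le_sum fun t (_ : t ∈ Finset.univ) => hstep t
  rw [Fin.sum_univ_eq_sum_range
      (fun t => smoothMax (ν (t + 1)) (Y (t + 1)) - smoothMax (ν t) (Y t)) T,
    Finset.sum_range_sub (fun t => smoothMax (ν t) (Y t)), Finset.sum_add_distrib,
    ← Finset.mul_sum] at htel
  have hend : smoothMax (ν T) (Y T) = ⨆ i, ∑ t, y t i := by
    have hST : S T = ∅ := by simp [S, Finset.filter_eq_empty_iff]
    simp [smoothMax, ν, hST, Y]
  have hstart : smoothMax (ν 0) (Y 0) ≤ 2 * √(T * L) := by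
    have h := (hν ⟨0, hT⟩).smoothMax_zero_le (hpos ⟨0, hT⟩) hcard
    have hY0 : Y 0 = 0 := by ext; simp [Y]
    simpa [hY0, hL] using h
  have hsum := mul_le_mul_of_nonneg_left (sum_one_div_sqrt_sub_le T) (Real.sqrt_nonneg L)
  rw [hend] at htel
  rw [Real.sqrt_mul (Nat.cast_nonneg T)] at hstart ⊢
  linarith
end
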